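/- There exist 57 distinct points in ℝ² and a set E of 114 unordered pairs of these points such that every point is an endpoint of exactly 4 pairs in E, the closed segments of any two distinct pairs intersect at most in a common endpoint, exactly 111 of the pairs join points at distance exactly 1, and the remaining 3 pairs all join points at one common distance t with |t − 1| < 0.013. -/

import Mathlib

open scoped Classical

namespace NM
noncomputable section

lemma sqrt3_bd : (1.7320508:ℝ) ≤ √3 ∧ √3 ≤ 1.7320509 :=
  ⟨Real.le_sqrt_of_sq_le (by norm_num), Real.sqrt_le_iff.2 ⟨by norm_num, by norm_num⟩⟩

def fy (x : ℝ) : ℝ := √(1 - x^2)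
def fh (x : ℝ) : ℝ := √((4*x-1)/(4*(5-4*x)))
def fu1 (x : ℝ) : ℝ := (2-x)/2 - fy x * fh x
def fu2 (x : ℝ) : ℝ := -(fy x)/2 - fh x * (2-x)
def fd1 (x : ℝ) : ℝ := (fu1 x + 3/2*x + √3/2*fy x - 5/2)/2
def fd2 (x : ℝ) : ℝ := (fu2 x + 3/2*fy x - √3/2*x - √3/2)/2

lemma cont_F : ContinuousOn (fun x => fd1 x^2 + fd2 x^2) (Set.Icc 0.892806 0.892807) := by
  have hy : Continuous fy := by unfold fy; fun_prop
  have hh : ContinuousOn fh (Set.Icc 0.892806 0.892807) := by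
    unfold fh
    apply ContinuousOn.sqrt
    apply ContinuousOn.div (by fun_prop) (by fun_prop)
    intro x hx
    have := hx.2
    have : 0 < 4*(5-4*x) := by norm_num at this; linarith
    exact this.ne'
  unfold fd1 fd2 fu1 fu2
  fun_prop

lemma mulbd {a b al ah bl bh : ℝ} (h0 : 0 ≤ al) (h1 : 0 ≤ bl) (ha : al ≤ a ∧ a ≤ ah) (hb : bl ≤ b ∧ b ≤ bh) :
    al*bl ≤ a*b ∧ a*b ≤ ah*bh :=
  ⟨mul_le_mul ha.1 hb.1 h1 (h0.trans ha.1), mul_le_mul ha.2 hb.2 (h1.trans hb.1) (h0.trans (ha.1.trans ha.2))⟩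

lemma fy_bd {x xl xh yl yh : ℝ} (h0 : 0 ≤ xl) (hx : xl ≤ x ∧ x ≤ xh) (h2 : 0 ≤ yh) (hl : yl^2 ≤ 1 - xh^2)
    (hh : 1 - xl^2 ≤ yh^2) : yl ≤ fy x ∧ fy x ≤ yh := by
  constructor
  · apply Real.le_sqrt_of_sq_le; nlinarith
  · apply Real.sqrt_le_iff.2 ⟨h2, by nlinarith⟩

lemma fh_bd {x xl xh yl yh : ℝ} (hx : xl ≤ x ∧ x ≤ xh) (h5 : xh ≤ 1) (h2 : 0 ≤ yh)
    (hl : yl^2*(4*(5-4*xl)) ≤ (4*xl-1))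
    (hh : (4*xh-1) ≤ yh^2*(4*(5-4*xh))) : yl ≤ fh x ∧ fh x ≤ yh := by
  have hp : 0 < 4*(5-4*x) := by linarith
  constructor
  · apply Real.le_sqrt_of_sq_le
    rw [le_div_iff₀ hp]
    nlinarith [sq_nonneg yl, mul_nonneg (sq_nonneg yl) (sub_nonneg.2 hx.1)]
  · apply Real.sqrt_le_iff.2 ⟨h2, ?_⟩
    rw [div_le_iff₀ hp]
    nlinarith [sq_nonneg yh, mul_nonneg (sq_nonneg yh) (sub_nonneg.2 hx.2)]

lemma F_lo : fd1 0.892806^2 + fd2 0.892806^2 ≤ 1 := by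
  have hr := sqrt3_bd
  have hy := fy_bd (x := 0.892806) (xl := 0.892806) (xh := 0.892806) (yl := 0.45044139) (yh := 0.450441391) (by norm_num) ⟨le_rfl, le_rfl⟩ (by norm_num) (by norm_num) (by norm_num)
  have hh := fh_bd (x := 0.892806) (xl := 0.892806) (xh := 0.892806) (yl := 0.670745685) (yh := 0.670745686) ⟨le_rfl, le_rfl⟩ (by norm_num) (by norm_num) (by norm_num) (by norm_num)
  have p1 := mulbd (by norm_num) (by norm_num) hy hh
  have p2 := mulbd (by norm_num) (by norm_num) hr hy
  have e1 : -0.2596162 ≤ fd1 0.892806 ∧ fd1 0.892806 ≤ 0 := by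
    unfold fd1 fu1
    generalize fy 0.892806 = y at *
    generalize fh 0.892806 = h at *
    norm_num at *
    constructor <;> linarith
  have e2 : -0.9657113 ≤ fd2 0.892806 ∧ fd2 0.892806 ≤ 0 := by
    unfold fd2 fu2
    generalize fy 0.892806 = y at *
    generalize fh 0.892806 = h at *
    norm_num at *
    constructor <;> linarith
  generalize fd1 0.892806 = d at *
  generalize fd2 0.892806 = e at *
  nlinarith

lemma F_hi : 1 ≤ fd1 0.892807^2 + fd2 0.892807^2 := by
  have hr := sqrt3_bd
  have hy := fy_bd (x := 0.892807) (xl := 0.892807) (xh := 0.892807) (yl := 0.450439408) (yh := 0.450439409) (by norm_num) ⟨le_rfl, le_rfl⟩ (by norm_num) (by norm_num) (by norm_num)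
  have hh := fh_bd (x := 0.892807) (xl := 0.892807) (xh := 0.892807) (yl := 0.670747145) (yh := 0.670747146) ⟨le_rfl, le_rfl⟩ (by norm_num) (by norm_num) (by norm_num) (by norm_num)
  have p1 := mulbd (by norm_num) (by norm_num) hy hh
  have p2 := mulbd (by norm_num) (by norm_num) hr hy
  have e1 : fd1 0.892807 ≤ -0.2596158 := by
    unfold fd1 fu1
    generalize fy 0.892807 = y at *
    generalize fh 0.892807 = h at *
    norm_num at *
    linarith
  have e2 : fd2 0.892807 ≤ -0.9657129 := by
    unfold fd2 fu2
    generalize fy 0.892807 = y at *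
    generalize fh 0.892807 = h at *
    norm_num at *
    linarith
  generalize fd1 0.892807 = d at *
  generalize fd2 0.892807 = e at *
  nlinarith

lemma exist_uvd : ∃ u1 u2 v1 v2 d1 d2 : ℝ, u1^2+u2^2=1 ∧ v1^2+v2^2=1 ∧ d1^2+d2^2=1 ∧
    (2-u1-v1)^2+(u2+v2)^2=1 ∧ 2*d1 = u1+3/2*v1+√3/2*v2-5/2 ∧ 2*d2 = u2+3/2*v2-√3/2*v1-√3/2 ∧
    |u1-0.251465|≤0.000005 ∧ |u2+0.967866|≤0.00001 ∧ |v1-0.892806|≤0.000005 ∧ |v2-0.450440|≤0.000005 ∧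
    |d1+0.259616|≤0.000005 ∧ |d2+0.965712|≤0.000005 := by
  obtain ⟨x, hx, hF⟩ := intermediate_value_Icc (by norm_num) cont_F ⟨F_lo, F_hi⟩
  have hx : (0.892806:ℝ) ≤ x ∧ x ≤ 0.892807 := hx
  have hr := sqrt3_bd
  have hy := fy_bd (yl := 0.450439) (yh := 0.450442) (by norm_num) hx (by norm_num) (by norm_num) (by norm_num)
  have hh := fh_bd (yl := 0.670745) (yh := 0.670748) hx (by norm_num) (by norm_num) (by norm_num) (by norm_num)
  have sy : fy x^2 = 1 - x^2 := Real.sq_sqrt (by nlinarith)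
  have hp : 0 < 4*(5-4*x) := by linarith
  have sh : fh x^2 = (4*x-1)/(4*(5-4*x)) := Real.sq_sqrt (div_nonneg (by linarith) hp.le)
  rw [eq_div_iff hp.ne'] at sh
  have p1 := mulbd (by norm_num) (by norm_num) hy hh
  have p2 := mulbd (by norm_num) (by norm_num) hr hy
  have p3 := mulbd (by norm_num) (by norm_num) hh hx
  have p4 := mulbd (by norm_num) (by norm_num) hr hx
  refine ⟨fu1 x, fu2 x, x, fy x, fd1 x, fd2 x, ?_, ?_, hF, ?_, ?_, ?_, ?_, ?_, ?_, ?_, ?_, ?_⟩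
  · unfold fu1 fu2
    linear_combination (1/4 + fh x^2) * sy + 1/4*sh
  · linarith
  · unfold fu1 fu2
    linear_combination (1/4 + fh x^2) * sy + 1/4*sh
  · unfold fd1; ring
  · unfold fd2; ring
  all_goals (try unfold fd1); (try unfold fd2); (try unfold fu1); (try unfold fu2); generalize fy x = y at *; generalize fh x = h at *; norm_num at *; rw [abs_le]; constructor <;> linarith

lemma exist_c {u1 u2 : ℝ} (h1 : |u1-0.251465|≤0.000005) (h2 : |u2+0.967866|≤0.00001) :
    ∃ c1 c2 : ℝ, c1^2+c2^2=1 ∧ (-1/2+2*c1-u1)^2+(√3/2+2*c2-u2)^2=1 ∧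
    |c1+0.118456|≤0.00005 ∧ |c2+0.992959|≤0.00005 := by
  have hr := sqrt3_bd
  rw [abs_le] at h1 h2
  obtain ⟨g1, hg1⟩ : ∃ g, g = u1+1/2 := ⟨_, rfl⟩
  obtain ⟨g2, hg2⟩ : ∃ g, g = √3/2-u2 := ⟨_, rfl⟩
  have b1 : (0.751460:ℝ) ≤ g1 ∧ g1 ≤ 0.751470 := by norm_num at *; constructor <;> linarith
  have b2 : (1.833881:ℝ) ≤ g2 ∧ g2 ≤ 1.833902 := by norm_num at *; constructor <;> linarith
  have q1 := mulbd (by norm_num) (by norm_num) b1 b1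
  have q2 := mulbd (by norm_num) (by norm_num) b2 b2
  obtain ⟨D, hD⟩ : ∃ D, D = g1*g1+g2*g2 := ⟨_, rfl⟩
  have bD : (3.92780:ℝ) ≤ D ∧ D ≤ 3.92792 := by norm_num at *; constructor <;> linarith
  have hDp : 0 < D := by norm_num at *; linarith
  obtain ⟨X, hX⟩ : ∃ X, X = (D+3)/(2*D) := ⟨_, rfl⟩
  have bX : (0.881881:ℝ) ≤ X ∧ X ≤ 0.881894 := by
    rw [hX]; constructor
    · rw [le_div_iff₀ (by linarith)]; norm_num at *; linarith
    · rw [div_le_iff₀ (by linarith)]; norm_num at *; linarith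
  have qX := mulbd (by norm_num) (by norm_num) bX bX
  obtain ⟨V, hV⟩ : ∃ V, V = 4/D := ⟨_, rfl⟩
  have bV : (1.018350:ℝ) ≤ V ∧ V ≤ 1.018382 := by
    rw [hV]; constructor
    · rw [le_div_iff₀ (by linarith)]; norm_num at *; linarith
    · rw [div_le_iff₀ (by linarith)]; norm_num at *; linarith
  have hY2 : √(V - X*X)^2 = V - X*X := Real.sq_sqrt (by norm_num at *; linarith)
  have bY : (0.490520:ℝ) ≤ √(V - X*X) ∧ √(V - X*X) ≤ 0.490585 := by
    constructor
    · apply Real.le_sqrt_of_sq_le; norm_num at *; linarith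
    · apply Real.sqrt_le_iff.2 ⟨by norm_num, by norm_num at *; linarith⟩
  generalize √(V - X*X) = Y at *
  have hVD : V * D = 4 := by rw [hV]; field_simp
  have hXD : X * (2*D) = D+3 := by rw [hX]; field_simp
  have r1 := mulbd (by norm_num) (by norm_num) b1 bX
  have r2 := mulbd (by norm_num) (by norm_num) b2 bX
  have r3 := mulbd (by norm_num) (by norm_num) b1 bY
  have r4 := mulbd (by norm_num) (by norm_num) b2 bY
  have e1 : ((g1*X-g2*Y)/2)^2+((-g2*X-g1*Y)/2)^2=1 := by
    linear_combination (D/4)*hY2 + 1/4*hVD - (X^2+Y^2)/4*hD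
  refine ⟨(g1*X-g2*Y)/2, (-g2*X-g1*Y)/2, e1, ?_, ?_, ?_⟩
  · have hu1 : u1 = g1 - 1/2 := by linarith
    have hu2 : u2 = √3/2 - g2 := by linarith
    rw [hu1, hu2]
    linear_combination 4*e1 - hXD + (2*X-1)*hD
  · norm_num at *; rw [abs_le]; constructor <;> linarith
  · norm_num at *; rw [abs_le]; constructor <;> linarith
end
def CX : List ℕ := [44818, 26569, 18562, 73068, 63407, 53746, 36453, 27753, 19746, 66003, 56342, 45381, 33938, 28938, 38938, 48938, 58938, 53938, 43938, 33050, 38746, 37561, 10555, 17620, 24685, 32487, 29554, 28370, 7959, 15024, 24122, 25363, 20363, 15363, 10363, 5363, 15363, 20363, 42132, 54685, 63877, 36377, 38973, 41569, 51060, 62692, 71884, 46038, 48634, 50497, 60699, 70699, 65699, 60699, 55699, 50699, 55699]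
def CY : List ℕ := [45243, 49203, 55193, 54908, 52328, 49748, 50723, 59132, 65123, 61985, 59405, 55227, 60402, 69062, 69062, 69062, 69062, 60402, 60402, 41551, 23767, 13837, 61184, 54107, 47030, 31566, 19828, 9898, 51527, 44450, 37046, 24549, 15889, 24549, 33210, 41870, 41870, 33210, 33206, 47030, 50969, 3908, 13565, 23222, 37711, 41040, 44979, 6488, 16145, 27726, 35049, 35049, 26389, 17728, 9068, 17728, 26389]
def base : List (ℕ × ℕ × ℕ) := [(1,2,0), (2,3,1), (3,4,0), (4,5,0), (5,0,0), (0,6,0), (6,1,0), (1,7,0), (7,2,0), (2,8,0), (8,3,1), (3,9,0), (9,4,0), (4,10,0), (10,5,0), (5,11,0), (11,0,0), (11,6,0), (6,12,0), (12,13,0), (13,7,0), (7,8,0), (8,13,0), (13,14,0), (14,15,0), (15,16,0), (16,9,0), (9,10,0), (10,16,0), (16,17,0), (17,11,0), (17,18,0), (18,12,0), (12,14,0), (14,18,0), (18,15,0), (15,17,0)]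
def bx (n : ℕ) : ℕ := CX.getD n 0
def byy (n : ℕ) : ℕ := CY.getD n 0
def mk (k : ℕ) (t : ℕ × ℕ × ℕ) : ℕ × ℕ :=
  if 19*k+t.1 < 19*((k+t.2.2)%3)+t.2.1 then (19*k+t.1, 19*((k+t.2.2)%3)+t.2.1)
  else (19*((k+t.2.2)%3)+t.2.1, 19*k+t.1)
def goodN : List (ℕ × ℕ) := base.map (mk 0) ++ base.map (mk 1) ++ base.map (mk 2)
def badN : List (ℕ × ℕ) := [mk 0 (0,1,2), mk 1 (0,1,2), mk 2 (0,1,2)]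
structure EE where
  i : ℕ
  j : ℕ
  a : ℕ
  b : ℕ
  c : ℕ
  d : ℕ
deriving DecidableEq
def EC : List EE := [⟨1,2,26569,49203,18562,55193⟩, ⟨2,22,18562,55193,10555,61184⟩, ⟨3,4,73068,54908,63407,52328⟩, ⟨4,5,63407,52328,53746,49748⟩, ⟨0,5,44818,45243,53746,49748⟩, ⟨0,6,44818,45243,36453,50723⟩, ⟨1,6,26569,49203,36453,50723⟩, ⟨1,7,26569,49203,27753,59132⟩, ⟨2,7,18562,55193,27753,59132⟩, ⟨2,8,18562,55193,19746,65123⟩, ⟨8,22,19746,65123,10555,61184⟩, ⟨3,9,73068,54908,66003,61985⟩, ⟨4,9,63407,52328,66003,61985⟩, ⟨4,10,63407,52328,56342,59405⟩, ⟨5,10,53746,49748,56342,59405⟩, ⟨5,11,53746,49748,45381,55227⟩, ⟨0,11,44818,45243,45381,55227⟩, ⟨6,11,36453,50723,45381,55227⟩, ⟨6,12,36453,50723,33938,60402⟩, ⟨12,13,33938,60402,28938,69062⟩, ⟨7,13,27753,59132,28938,69062⟩, ⟨7,8,27753,59132,19746,65123⟩, ⟨8,13,19746,65123,28938,69062⟩,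 ⟨13,14,28938,69062,38938,69062⟩, ⟨14,15,38938,69062,48938,69062⟩, ⟨15,16,48938,69062,58938,69062⟩, ⟨9,16,66003,61985,58938,69062⟩, ⟨9,10,66003,61985,56342,59405⟩, ⟨10,16,56342,59405,58938,69062⟩, ⟨16,17,58938,69062,53938,60402⟩, ⟨11,17,45381,55227,53938,60402⟩, ⟨17,18,53938,60402,43938,60402⟩, ⟨12,18,33938,60402,43938,60402⟩, ⟨12,14,33938,60402,38938,69062⟩, ⟨14,18,38938,69062,43938,60402⟩, ⟨15,18,48938,69062,43938,60402⟩, ⟨15,17,48938,69062,53938,60402⟩, ⟨20,21,38746,23767,37561,13837⟩, ⟨21,41,37561,13837,36377,3908⟩, ⟨22,23,10555,61184,17620,54107⟩, ⟨23,24,17620,54107,24685,47030⟩, ⟨19,24,33050,41551,24685,47030⟩, ⟨19,25,33050,41551,32487,31566⟩, ⟨20,25,38746,23767,32487,31566⟩, ⟨20,26,38746,23767,29554,19828⟩, ⟨21,26,37561,13837,29554,19828⟩, ⟨21,27,37561,13837,28370,9898⟩, ⟨27,41,28370,9898,36377,3908⟩, ⟨22,28,10555,61184,7959,51527⟩, ⟨23,28,17620,54107,7959,51527⟩,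 ⟨23,29,17620,54107,15024,44450⟩, ⟨24,29,24685,47030,15024,44450⟩, ⟨24,30,24685,47030,24122,37046⟩, ⟨19,30,33050,41551,24122,37046⟩, ⟨25,30,32487,31566,24122,37046⟩, ⟨25,31,32487,31566,25363,24549⟩, ⟨31,32,25363,24549,20363,15889⟩, ⟨26,32,29554,19828,20363,15889⟩, ⟨26,27,29554,19828,28370,9898⟩, ⟨27,32,28370,9898,20363,15889⟩, ⟨32,33,20363,15889,15363,24549⟩, ⟨33,34,15363,24549,10363,33210⟩, ⟨34,35,10363,33210,5363,41870⟩, ⟨28,35,7959,51527,5363,41870⟩, ⟨28,29,7959,51527,15024,44450⟩, ⟨29,35,15024,44450,5363,41870⟩, ⟨35,36,5363,41870,15363,41870⟩, ⟨30,36,24122,37046,15363,41870⟩, ⟨36,37,15363,41870,20363,33210⟩, ⟨31,37,25363,24549,20363,33210⟩, ⟨31,33,25363,24549,15363,24549⟩, ⟨33,37,15363,24549,20363,33210⟩, ⟨34,37,10363,33210,20363,33210⟩, ⟨34,36,10363,33210,15363,41870⟩, ⟨39,40,54685,47030,63877,50969⟩, ⟨3,40,73068,54908,63877,50969⟩, ⟨41,42,36377,3908,38973,13565⟩,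 ⟨42,43,38973,13565,41569,23222⟩, ⟨38,43,42132,33206,41569,23222⟩, ⟨38,44,42132,33206,51060,37711⟩, ⟨39,44,54685,47030,51060,37711⟩, ⟨39,45,54685,47030,62692,41040⟩, ⟨40,45,63877,50969,62692,41040⟩, ⟨40,46,63877,50969,71884,44979⟩, ⟨3,46,73068,54908,71884,44979⟩, ⟨41,47,36377,3908,46038,6488⟩, ⟨42,47,38973,13565,46038,6488⟩, ⟨42,48,38973,13565,48634,16145⟩, ⟨43,48,41569,23222,48634,16145⟩, ⟨43,49,41569,23222,50497,27726⟩, ⟨38,49,42132,33206,50497,27726⟩, ⟨44,49,51060,37711,50497,27726⟩, ⟨44,50,51060,37711,60699,35049⟩, ⟨50,51,60699,35049,70699,35049⟩, ⟨45,51,62692,41040,70699,35049⟩, ⟨45,46,62692,41040,71884,44979⟩, ⟨46,51,71884,44979,70699,35049⟩, ⟨51,52,70699,35049,65699,26389⟩, ⟨52,53,65699,26389,60699,17728⟩, ⟨53,54,60699,17728,55699,9068⟩, ⟨47,54,46038,6488,55699,9068⟩, ⟨47,48,46038,6488,48634,16145⟩, ⟨48,54,48634,16145,55699,9068⟩, ⟨54,55,55699,9068,50699,17728⟩,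 ⟨49,55,50497,27726,50699,17728⟩, ⟨55,56,50699,17728,55699,26389⟩, ⟨50,56,60699,35049,55699,26389⟩, ⟨50,52,60699,35049,65699,26389⟩, ⟨52,56,65699,26389,55699,26389⟩, ⟨53,56,60699,17728,55699,26389⟩, ⟨53,55,60699,17728,50699,17728⟩, ⟨0,39,44818,45243,54685,47030⟩, ⟨1,19,26569,49203,33050,41551⟩, ⟨20,38,38746,23767,42132,33206⟩]
def lt (a b : ℤ) : Bool := decide (a < b)
def sepN (a b c d a' b' c' d' n1 n2 : ℤ) : Bool :=
  lt (n1*a+n2*b + 8*(|n1|+|n2|)) (n1*a'+n2*b') &&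
  (lt (n1*c+n2*d + 8*(|n1|+|n2|)) (n1*c'+n2*d') &&
  (lt (n1*a+n2*b + 8*(|n1|+|n2|)) (n1*c'+n2*d') &&
  lt (n1*c+n2*d + 8*(|n1|+|n2|)) (n1*a'+n2*b')))
def sepB (a b c d a' b' c' d' : ℤ) : Bool :=
  sepN a b c d a' b' c' d' 1 0 || (sepN a b c d a' b' c' d' (-1) 0 ||
  (sepN a b c d a' b' c' d' 0 1 || (sepN a b c d a' b' c' d' 0 (-1) ||
  (sepN a b c d a' b' c' d' (d-b) (a-c) || (sepN a b c d a' b' c' d' (b-d) (c-a) ||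
  (sepN a b c d a' b' c' d' (d'-b') (a'-c') || (sepN a b c d a' b' c' d' (b'-d') (c'-a') ||
  (sepN a b c d a' b' c' d' (c-a) (d-b) || sepN a b c d a' b' c' d' (a-c) (b-d)))))))))
def adjC (x1 x2 y1 y2 : ℤ) : Bool :=
  lt (8*(|x1|+|x2|+|y1|+|y2|)+128) (x1*y2-x2*y1) ||
  (lt (8*(|x1|+|x2|+|y1|+|y2|)+128) (x2*y1-x1*y2) ||
  lt (8*(|x1|+|x2|+|y1|+|y2|)+128) (-(x1*y1+x2*y2)))
def adjB (p q a b c d : ℤ) : Bool := adjC (a-p) (b-q) (c-p) (d-q)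
def pairOK (e f : EE) : Bool :=
  bif Nat.beq e.i f.i then adjB e.a e.b e.c e.d f.c f.d else
  bif Nat.beq e.i f.j then adjB e.a e.b e.c e.d f.a f.b else
  bif Nat.beq e.j f.i then adjB e.c e.d e.a e.b f.c f.d else
  bif Nat.beq e.j f.j then adjB e.c e.d e.a e.b f.a f.b else
  sepB e.a e.b e.c e.d f.a f.b f.c f.d
def chk : List EE → Bool
  | [] => true
  | e :: l => l.all (pairOK e) && chk l

lemma EC_eq : (goodN ++ badN).map (fun e => EE.mk e.1 e.2 (bx e.1) (byy e.1) (bx e.2) (byy e.2)) = EC := by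
  decide +kernel
set_option maxRecDepth 100000 in
lemma chk_EC : chk EC = true := by decide +kernel

def Ap (X : ℝ) (a : ℤ) : Prop := |X - a| ≤ 4

lemma lin_err {n X : ℝ} {a : ℝ} (h : |X - a| ≤ 4) : |n*X - n*a| ≤ 4*|n| := by
  rw [← mul_sub, abs_mul, mul_comm 4]
  exact mul_le_mul_of_nonneg_left h (abs_nonneg _)

lemma lt_sound {a b c d n1 n2 : ℤ} {A B C D : ℝ} (ha : Ap A a) (hb : Ap B b) (hc : Ap C c) (hd : Ap D d)
    (h : lt (n1*a+n2*b + 8*(|n1|+|n2|)) (n1*c+n2*d) = true) :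
    (n1:ℝ)*A+n2*B < n1*C+n2*D := by
  have h := of_decide_eq_true h
  have h' : (n1:ℝ)*a+n2*b + 8*(|(n1:ℝ)|+|(n2:ℝ)|) < n1*c+n2*d := by exact_mod_cast h
  have := abs_le.1 (lin_err (n := n1) ha)
  have := abs_le.1 (lin_err (n := n2) hb)
  have := abs_le.1 (lin_err (n := n1) hc)
  have := abs_le.1 (lin_err (n := n2) hd)
  linarith

/-- no common point of the segments AB, CD (coordinates) -/
def NoCommon (A B C D A' B' C' D' : ℝ) : Prop :=
  ∀ s t s' t' : ℝ, 0 ≤ s → 0 ≤ t → s+t=1 → 0 ≤ s' → 0 ≤ t' → s'+t'=1 →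
    s*A+t*C = s'*A'+t'*C' → s*B+t*D = s'*B'+t'*D' → False

lemma sep_real {A B C D A' B' C' D' n1 n2 : ℝ}
    (h1 : n1*A+n2*B < n1*A'+n2*B') (h2 : n1*C+n2*D < n1*C'+n2*D')
    (h3 : n1*A+n2*B < n1*C'+n2*D') (h4 : n1*C+n2*D < n1*A'+n2*B') : NoCommon A B C D A' B' C' D' := by
  intro s t s' t' hs ht hst hs' ht' hst' e1 e2
  have key : s*(n1*A+n2*B)+t*(n1*C+n2*D) = s'*(n1*A'+n2*B')+t'*(n1*C'+n2*D') := by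
    linear_combination n1*e1+n2*e2
  generalize n1*A+n2*B = p at *
  generalize n1*C+n2*D = q at *
  generalize n1*A'+n2*B' = p' at *
  generalize n1*C'+n2*D' = q' at *
  have u1 : s*p+t*q ≤ max p q := by
    have := mul_le_mul_of_nonneg_left (le_max_left p q) hs
    have := mul_le_mul_of_nonneg_left (le_max_right p q) ht
    calc _ ≤ s * max p q + t * max p q := by linarith
      _ = max p q := by rw [← add_mul, hst, one_mul]
  have u2 : min p' q' ≤ s'*p'+t'*q' := by
    have := mul_le_mul_of_nonneg_left (min_le_left p' q') hs'
    have := mul_le_mul_of_nonneg_left (min_le_right p' q') ht'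
    calc min p' q' = s' * min p' q' + t' * min p' q' := by rw [← add_mul, hst', one_mul]
      _ ≤ _ := by linarith
  have : max p q < min p' q' := max_lt (lt_min h1 h3) (lt_min h4 h2)
  linarith

lemma sepN_sound {a b c d a' b' c' d' n1 n2 : ℤ} {A B C D A' B' C' D' : ℝ}
    (ha : Ap A a) (hb : Ap B b) (hc : Ap C c) (hd : Ap D d)
    (ha' : Ap A' a') (hb' : Ap B' b') (hc' : Ap C' c') (hd' : Ap D' d')
    (h : sepN a b c d a' b' c' d' n1 n2 = true) : NoCommon A B C D A' B' C' D' := by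
  simp only [sepN, Bool.and_eq_true] at h
  obtain ⟨h1, h2, h3, h4⟩ := h
  exact sep_real (lt_sound ha hb ha' hb' h1) (lt_sound hc hd hc' hd' h2)
    (lt_sound ha hb hc' hd' h3) (lt_sound hc hd ha' hb' h4)

lemma sepB_sound {a b c d a' b' c' d' : ℤ} {A B C D A' B' C' D' : ℝ}
    (ha : Ap A a) (hb : Ap B b) (hc : Ap C c) (hd : Ap D d)
    (ha' : Ap A' a') (hb' : Ap B' b') (hc' : Ap C' c') (hd' : Ap D' d')
    (h : sepB a b c d a' b' c' d' = true) : NoCommon A B C D A' B' C' D' := by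
  simp only [sepB, Bool.or_eq_true] at h
  rcases h with h | h | h | h | h | h | h | h | h | h <;>
  exact sepN_sound ha hb hc hd ha' hb' hc' hd' h

lemma prod_err {x y : ℝ} {X Y : ℝ} (hx : |X - x| ≤ 8) (hy : |Y - y| ≤ 8) :
    |X*Y - x*y| ≤ 8*|x|+8*|y|+64 := by
  have e : X*Y-x*y = (X-x)*(Y-y) + x*(Y-y) + y*(X-x) := by ring
  rw [e]
  have h1 : |(X-x)*(Y-y)| ≤ 8*8 := by
    rw [abs_mul]; exact mul_le_mul hx hy (abs_nonneg _) (by norm_num)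
  have h2 : |x*(Y-y)| ≤ |x| * 8 := by rw [abs_mul]; exact mul_le_mul_of_nonneg_left hy (abs_nonneg _)
  have h3 : |y*(X-x)| ≤ |y| * 8 := by rw [abs_mul]; exact mul_le_mul_of_nonneg_left hx (abs_nonneg _)
  have := abs_add_le ((X-x)*(Y-y) + x*(Y-y)) (y*(X-x))
  have := abs_add_le ((X-x)*(Y-y)) (x*(Y-y))
  linarith

/-- the segments from the common point PQ meet only there -/
def OnlyP (P Q A B C D : ℝ) : Prop :=
  ∀ t t' : ℝ, 0 ≤ t → 0 ≤ t' → t*(A-P) = t'*(C-P) → t*(B-Q) = t'*(D-Q) → t = 0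

lemma Ap_sub {P A : ℝ} {p a : ℤ} (hp : Ap P p) (ha : Ap A a) : |(A-P) - ((a-p : ℤ):ℝ)| ≤ 8 := by
  unfold Ap at *
  push_cast
  rw [abs_le] at *
  constructor <;> linarith

lemma adjB_sound {p q a b c d : ℤ} {P Q A B C D : ℝ}
    (hp : Ap P p) (hq : Ap Q q) (ha : Ap A a) (hb : Ap B b) (hc : Ap C c) (hd : Ap D d)
    (h : adjB p q a b c d = true) : OnlyP P Q A B C D := by
  intro t t' ht ht' e1 e2
  have k1 := Ap_sub hp ha
  have k2 := Ap_sub hq hb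
  have k3 := Ap_sub hp hc
  have k4 := Ap_sub hq hd
  unfold adjB at h
  generalize A - P = X1 at *
  generalize B - Q = X2 at *
  generalize C - P = Y1 at *
  generalize D - Q = Y2 at *
  generalize a - p = x1 at *
  generalize b - q = x2 at *
  generalize c - p = y1 at *
  generalize d - q = y2 at *
  have m1 := abs_le.1 (prod_err k1 k4)
  have m2 := abs_le.1 (prod_err k2 k3)
  have m3 := abs_le.1 (prod_err k1 k3)
  have m4 := abs_le.1 (prod_err k2 k4)
  simp only [adjC, Bool.or_eq_true] at h
  have hcr : X1*Y2-X2*Y1 ≠ 0 ∨ X1*Y1+X2*Y2 < 0 := by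
    rcases h with h | h | h
    · left
      have h := of_decide_eq_true h
      have h' : 8*(|(x1:ℝ)|+|(x2:ℝ)|+|(y1:ℝ)|+|(y2:ℝ)|)+128 < x1*y2-x2*y1 := by exact_mod_cast h
      have : 0 < X1*Y2-X2*Y1 := by linarith
      exact this.ne'
    · left
      have h := of_decide_eq_true h
      have h' : 8*(|(x1:ℝ)|+|(x2:ℝ)|+|(y1:ℝ)|+|(y2:ℝ)|)+128 < x2*y1-x1*y2 := by exact_mod_cast h
      have : X1*Y2-X2*Y1 < 0 := by linarith
      exact this.ne
    · right
      have h := of_decide_eq_true h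
      have h' : 8*(|(x1:ℝ)|+|(x2:ℝ)|+|(y1:ℝ)|+|(y2:ℝ)|)+128 < -(x1*y1+x2*y2) := by exact_mod_cast h
      linarith
  rcases hcr with h | h
  · have : t * (X1*Y2-X2*Y1) = 0 := by linear_combination Y2*e1 - Y1*e2
    exact (mul_eq_zero.1 this).resolve_right h
  · have e : t * (X1^2+X2^2) = t' * (X1*Y1+X2*Y2) := by linear_combination X1*e1+X2*e2
    have : t' * (X1*Y1+X2*Y2) ≤ 0 := mul_nonpos_of_nonneg_of_nonpos ht' h.le
    have pos : 0 < X1^2+X2^2 := by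
      rcases eq_or_ne X1 0 with h1 | h1
      · rcases eq_or_ne X2 0 with h2 | h2
        · subst h1 h2; simp at h
        · positivity
      · positivity
    by_contra hne
    have : 0 < t := lt_of_le_of_ne ht (Ne.symm hne)
    have := mul_pos this pos
    linarith

/-- the conclusion for a pair of edges, complex version -/
def Good (A B C D : ℂ) : Prop :=
  ∀ s t s' t' : ℝ, 0 ≤ s → 0 ≤ t → s+t=1 → 0 ≤ s' → 0 ≤ t' → s'+t'=1 →
    s*A.re+t*B.re = s'*C.re+t'*D.re → s*A.im+t*B.im = s'*C.im+t'*D.im →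
    (s = 0 ∨ t = 0) ∧ (s' = 0 ∨ t' = 0)

lemma Good.symm {A B C D : ℂ} (h : Good A B C D) : Good C D A B := by
  intro s t s' t' h1 h2 h3 h4 h5 h6 h7 h8
  exact (h s' t' s t h4 h5 h6 h1 h2 h3 h7.symm h8.symm).symm
lemma Good.swapL {A B C D : ℂ} (h : Good A B C D) : Good B A C D := by
  intro s t s' t' h1 h2 h3 h4 h5 h6 h7 h8
  have := (h t s s' t' h2 h1 (by linarith) h4 h5 h6 (by linarith) (by linarith))
  exact ⟨this.1.symm, this.2⟩
lemma Good.swapR {A B C D : ℂ} (h : Good A B C D) : Good A B D C := h.symm.swapL.symm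

def sc (X : ℝ) : ℝ := 10000*X+40000

lemma good_of_noCommon {A B C D : ℂ}
   (h : NoCommon (sc A.re) (sc A.im) (sc B.re) (sc B.im) (sc C.re) (sc C.im) (sc D.re) (sc D.im)) : Good A B C D := by
  intro s t s' t' h1 h2 h3 h4 h5 h6 h7 h8
  exfalso
  refine h s t s' t' h1 h2 h3 h4 h5 h6 ?_ ?_
  · unfold sc; linear_combination 10000*h7 + 40000*h3-40000*h6
  · unfold sc; linear_combination 10000*h8 + 40000*h3-40000*h6

lemma good_of_onlyP {A B C : ℂ} 
   (h : OnlyP (sc A.re) (sc A.im) (sc B.re) (sc B.im) (sc C.re) (sc C.im))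
   (h' : OnlyP (sc A.re) (sc A.im) (sc C.re) (sc C.im) (sc B.re) (sc B.im)) : Good A B A C := by
  intro s t s' t' h1 h2 h3 h4 h5 h6 h7 h8
  refine ⟨Or.inr (h t t' h2 h5 ?_ ?_), Or.inr (h' t' t h5 h2 ?_ ?_)⟩
  · unfold sc; linear_combination 10000*h7 -10000*A.re * h3 +10000*A.re*h6
  · unfold sc; linear_combination 10000*h8 -10000*A.im * h3 +10000*A.im*h6
  · unfold sc; linear_combination -10000*h7 +10000*A.re * h3 -10000*A.re*h6
  · unfold sc; linear_combination -10000*h8 +10000*A.im * h3 -10000*A.im*h6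

lemma adjB_comm {p q a b c d : ℤ} (h : adjB p q a b c d = true) : adjB p q c d a b = true := by
  simp only [adjB, adjC, lt, Bool.or_eq_true, decide_eq_true_eq] at *
  generalize a-p = x1 at *
  generalize b-q = x2 at *
  generalize c-p = y1 at *
  generalize d-q = y2 at *
  rcases h with h | h | h
  · right; left; linarith
  · left; linarith
  · right; right; linarith

lemma adj_good {w : ℕ → ℂ} (i j k : ℕ) 
   (hx : ∀ n < 57, Ap (sc (w n).re) (bx n)) (hy : ∀ n < 57, Ap (sc (w n).im) (byy n))
   (hi : i < 57) (hj : j < 57) (hk : k < 57)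
   (h : adjB (bx i) (byy i) (bx j) (byy j) (bx k) (byy k) = true) : Good (w i) (w j) (w i) (w k) :=
  good_of_onlyP (adjB_sound (hx _ hi) (hy _ hi) (hx _ hj) (hy _ hj) (hx _ hk) (hy _ hk) h)
   (adjB_sound (hx _ hi) (hy _ hi) (hx _ hk) (hy _ hk) (hx _ hj) (hy _ hj) (adjB_comm h))

def toEE (e : ℕ × ℕ) : EE := EE.mk e.1 e.2 (bx e.1) (byy e.1) (bx e.2) (byy e.2)

lemma pair_good {w : ℕ → ℂ} (e f : ℕ × ℕ)
   (hx : ∀ n < 57, Ap (sc (w n).re) (bx n)) (hy : ∀ n < 57, Ap (sc (w n).im) (byy n))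
   (h1 : e.1 < 57) (h2 : e.2 < 57) (h3 : f.1 < 57) (h4 : f.2 < 57)
   (h : pairOK (toEE e) (toEE f) = true) : Good (w e.1) (w e.2) (w f.1) (w f.2) := by
  unfold pairOK at h
  simp only [toEE] at h
  obtain ⟨i, j⟩ := e
  obtain ⟨k, l⟩ := f
  simp only [] at *
  rcases hb : Nat.beq i k with _ | _
  swap
  · have := Nat.eq_of_beq_eq_true hb
    subst this
    simp only [hb, cond_true] at h
    exact adj_good i j l hx hy h1 h2 h4 h
  rcases hb1 : Nat.beq i l with _ | _
  swap
  · have := Nat.eq_of_beq_eq_true hb1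
    subst this
    simp only [hb, hb1, cond_true, cond_false] at h
    exact (adj_good i j k hx hy h1 h2 h3 h).swapR
  rcases hb2 : Nat.beq j k with _ | _
  swap
  · have := Nat.eq_of_beq_eq_true hb2
    subst this
    simp only [hb, hb1, hb2, cond_true, cond_false] at h
    exact (adj_good j i l hx hy h2 h1 h4 h).swapL
  rcases hb3 : Nat.beq j l with _ | _
  swap
  · have := Nat.eq_of_beq_eq_true hb3
    subst this
    simp only [hb, hb1, hb2, hb3, cond_true, cond_false] at h
    exact (adj_good j i k hx hy h2 h1 h3 h).swapL.swapR
  simp only [hb, hb1, hb2, hb3, cond_false] at h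
  exact good_of_noCommon (sepB_sound (hx _ h1) (hy _ h1) (hx _ h2) (hy _ h2) (hx _ h3) (hy _ h3) (hx _ h4) (hy _ h4) h)

lemma chk_pw : ∀ l : List EE, chk l = true → l.Pairwise (fun e f => pairOK e f = true)
  | [], _ => List.Pairwise.nil
  | e :: l, h => by
    simp only [chk, Bool.and_eq_true, List.all_eq_true] at h
    exact List.Pairwise.cons h.1 (chk_pw l h.2)

lemma EN_lt : ∀ e ∈ goodN ++ badN, e.1 < e.2 ∧ e.2 < 57 := by decide +kernel
lemma EN_nodup : (goodN ++ badN).Nodup := by decide +kernel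

lemma all_good {w : ℕ → ℂ}
   (hx : ∀ n < 57, Ap (sc (w n).re) (bx n)) (hy : ∀ n < 57, Ap (sc (w n).im) (byy n)) :
   ∀ e ∈ goodN ++ badN, ∀ f ∈ goodN ++ badN, e ≠ f → Good (w e.1) (w e.2) (w f.1) (w f.2) := by
  have h := chk_pw EC chk_EC
  rw [← EC_eq, List.pairwise_map] at h
  have h' : (goodN ++ badN).Pairwise (fun e f => Good (w e.1) (w e.2) (w f.1) (w f.2)) := by
    refine List.Pairwise.imp_of_mem ?_ h
    intro e f he hf hef
    have a := EN_lt e he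
    have b := EN_lt f hf
    exact pair_good e f hx hy (a.1.trans a.2) a.2 (b.1.trans b.2) b.2 hef
  intro e he f hf hne
  have : Std.Symm (fun e f : ℕ × ℕ => Good (w e.1) (w e.2) (w f.1) (w f.2)) := ⟨fun _ _ h => h.symm⟩
  exact List.Pairwise.forall h' he hf hne
def toF (e : ℕ × ℕ) : Fin 57 × Fin 57 := (Fin.ofNat 57 e.1, Fin.ofNat 57 e.2)
def EL : List (Fin 57 × Fin 57) := (goodN ++ badN).map toF

lemma EL_nodup : EL.Nodup := by decide +kernel
lemma EL_len : EL.length = 114 := by decide +kernel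
lemma EL_deg : ∀ v : Fin 57, (EL.filter (fun e => decide (e.1 = v ∨ e.2 = v))).length = 4 := by decide +kernel
lemma good_len : (goodN.map toF).length = 111 := by decide +kernel
def apart (n m : ℕ) : Bool := lt (bx n + 8) (bx m) || (lt (bx m + 8) (bx n) || (lt (byy n + 8) (byy m) || lt (byy m + 8) (byy n)))
lemma apart_all : ∀ n < 57, ∀ m < n, apart n m = true := by decide +kernel

lemma toF_val {e : ℕ × ℕ} (h : e ∈ goodN ++ badN) : (toF e).1.val = e.1 ∧ (toF e).2.val = e.2 := by
  have := EN_lt e h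
  exact ⟨Nat.mod_eq_of_lt (this.1.trans this.2), Nat.mod_eq_of_lt this.2⟩

lemma EL_lt : ∀ e ∈ EL, e.1 < e.2 := by
  intro e he
  obtain ⟨f, hf, rfl⟩ := List.mem_map.1 he
  have h := toF_val hf
  rw [Fin.lt_def, h.1, h.2]
  exact (EN_lt f hf).1

lemma card_filter_toFinset {α : Type*} [DecidableEq α] (l : List α) (hl : l.Nodup) (p : α → Prop) [DecidablePred p] :
    (l.toFinset.filter p).card = (l.filter (fun e => decide (p e))).length := by
  rw [← List.toFinset_card_of_nodup (hl.filter _)]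
  congr 1
  ext x
  simp

lemma w_inj {w : ℕ → ℂ}
   (hx : ∀ n < 57, Ap (sc (w n).re) (bx n)) (hy : ∀ n < 57, Ap (sc (w n).im) (byy n))
   {n m : ℕ} (hn : n < 57) (hm : m < n) : w n ≠ w m := by
  intro h
  have a1 := abs_le.1 (hx n hn)
  have a2 := abs_le.1 (hy n hn)
  have a3 := abs_le.1 (hx m (hm.trans hn))
  have a4 := abs_le.1 (hy m (hm.trans hn))
  rw [h] at a1 a2
  have := apart_all n hn m hm
  simp only [apart, lt, Bool.or_eq_true, decide_eq_true_eq] at this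
  push_cast at a1 a2 a3 a4
  rcases this with h | h | h | h
  · have h' : (bx n:ℝ) + 8 < bx m := by exact_mod_cast h
    linarith
  · have h' : (bx m:ℝ) + 8 < bx n := by exact_mod_cast h
    linarith
  · have h' : (byy n:ℝ) + 8 < byy m := by exact_mod_cast h
    linarith
  · have h' : (byy m:ℝ) + 8 < byy n := by exact_mod_cast h
    linarith

def toP (x : ℂ) : EuclideanSpace ℝ (Fin 2) := !₂[x.re, x.im]

lemma toP_inj {x y : ℂ} (h : toP x = toP y) : x = y := by
  apply Complex.ext
  · simpa [toP] using congrArg (fun f => f 0) h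
  · simpa [toP] using congrArg (fun f => f 1) h

lemma toP_dist (x y : ℂ) : dist (toP x) (toP y) = ‖x - y‖ := by
  rw [EuclideanSpace.dist_eq, Complex.norm_eq_sqrt_sq_add_sq]
  simp [toP, Real.dist_eq, sq_abs]

lemma good_segment {A B C D : ℂ} (h : Good A B C D) : 
    ∀ x ∈ segment ℝ (toP A) (toP B) ∩ segment ℝ (toP C) (toP D),
          (x = toP A ∨ x = toP B) ∧ (x = toP C ∨ x = toP D) := by
  rintro x ⟨⟨s, t, hs, ht, hst, rfl⟩, ⟨s', t', hs', ht', hst', e⟩⟩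
  have e0 := congrArg (fun f => f 0) e
  have e1 := congrArg (fun f => f 1) e
  simp [toP] at e0 e1
  obtain ⟨h1, h2⟩ := h s t s' t' hs ht hst hs' ht' hst' e0.symm e1.symm
  constructor
  · rcases h1 with rfl | rfl
    · right
      have : t = 1 := by linarith
      simp [this]
    · left
      have : s = 1 := by linarith
      simp [this]
  · rw [← e]
    rcases h2 with rfl | rfl
    · right
      have : t' = 1 := by linarith
      simp [this]
    · left
      have : s' = 1 := by linarith
      simp [this]

lemma assemble (w : ℕ → ℂ) (t : ℝ)
   (hx : ∀ n < 57, Ap (sc (w n).re) (bx n)) (hy : ∀ n < 57, Ap (sc (w n).im) (byy n))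
   (hg : ∀ e ∈ goodN, ‖w e.1 - w e.2‖ = 1) (hb : ∀ e ∈ badN, ‖w e.1 - w e.2‖ = t)
   (ht1 : t ≠ 1) (ht : |t - 1| < 0.013) :
    ∃ (P : Fin 57 → EuclideanSpace ℝ (Fin 2)) (E : Finset (Fin 57 × Fin 57)),
      Function.Injective P ∧
      (∀ e ∈ E, e.1 < e.2) ∧
      E.card = 114 ∧
      (∀ v : Fin 57, (E.filter (fun e => e.1 = v ∨ e.2 = v)).card = 4) ∧
      (∀ e ∈ E, ∀ f ∈ E, e ≠ f →
        ∀ x ∈ segment ℝ (P e.1) (P e.2) ∩ segment ℝ (P f.1) (P f.2),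
          (x = P e.1 ∨ x = P e.2) ∧ (x = P f.1 ∨ x = P f.2)) ∧
      (E.filter (fun e => dist (P e.1) (P e.2) = 1)).card = 111 ∧
      (∃ t : ℝ, |t - 1| < 0.013 ∧
        ∀ e ∈ E, dist (P e.1) (P e.2) = 1 ∨ dist (P e.1) (P e.2) = t) := by
  have hg' : ∀ e ∈ goodN, dist (toP (w (toF e).1)) (toP (w (toF e).2)) = 1 := by
    intro e he
    have := toF_val (List.mem_append_left badN he)
    rw [this.1, this.2, toP_dist, hg e he]
  have hb' : ∀ e ∈ badN, dist (toP (w (toF e).1)) (toP (w (toF e).2)) = t := by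
    intro e he
    have := toF_val (List.mem_append_right goodN he)
    rw [this.1, this.2, toP_dist, hb e he]
  refine ⟨fun i => toP (w i), EL.toFinset, ?_, ?_, ?_, ?_, ?_, ?_, t, ht, ?_⟩
  · intro i j hij
    have hij := toP_inj hij
    rcases lt_trichotomy i.val j.val with h | h | h
    · exact absurd hij.symm (w_inj hx hy j.2 h)
    · exact Fin.ext h
    · exact absurd hij (w_inj hx hy i.2 h)
  · intro e he
    exact EL_lt e (List.mem_toFinset.1 he)
  · rw [List.toFinset_card_of_nodup EL_nodup, EL_len]
  · intro v
    have := EL_deg v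
    rw [← card_filter_toFinset EL EL_nodup] at this
    convert this
  · intro e he f hf hne
    obtain ⟨e, he1, rfl⟩ := List.mem_map.1 (List.mem_toFinset.1 he)
    obtain ⟨f, hf1, rfl⟩ := List.mem_map.1 (List.mem_toFinset.1 hf)
    have h := all_good hx hy e he1 f hf1 (fun h => hne (by rw [h]))
    have := toF_val he1
    have := toF_val hf1
    apply good_segment
    simp only [*]
  · have nd := EL_nodup
    have hEL : EL = goodN.map toF ++ badN.map toF := by simp [EL]
    rw [hEL] at nd ⊢
    have : ((goodN.map toF ++ badN.map toF).toFinset.filter (fun e => dist (toP (w e.1)) (toP (w e.2)) = 1)) = (goodN.map toF).toFinset := by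
      ext e
      simp only [Finset.mem_filter, List.mem_toFinset, List.mem_append]
      constructor
      · rintro ⟨h | h, h1⟩
        · exact h
        · obtain ⟨f, hf, rfl⟩ := List.mem_map.1 h
          rw [hb' f hf] at h1
          exact absurd h1 ht1
      · intro h
        refine ⟨Or.inl h, ?_⟩
        obtain ⟨f, hf, rfl⟩ := List.mem_map.1 h
        exact hg' f hf
    have h2 : (goodN.map toF).toFinset.card = 111 := by
      rw [List.toFinset_card_of_nodup (List.Nodup.of_append_left nd), good_len]
    rw [← h2, ← this]
  · intro e he
    obtain ⟨e, he1, rfl⟩ := List.mem_map.1 (List.mem_toFinset.1 he)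
    rcases List.mem_append.1 he1 with h | h
    · exact Or.inl (hg' e h)
    · exact Or.inr (hb' e h)
noncomputable section
def O (z d c : ℂ) : ℂ := 1 + (2/3)*(2-z)*c + (2/3)*(1+z)*d
def Q (z u v d c : ℂ) : ℕ → ℂ
  | 0 => u+(1-z)*v - O z d c
  | 1 => z-1+2*c - O z d c
  | 2 => z-1+c+(1-z)*c - O z d c
  | 3 => z+2+2*z*d - O z d c
  | 4 => z+2+d+z*d - O z d c
  | 5 => z+2+2*d - O z d c
  | 6 => u - O z d c
  | 7 => z-1+c - O z d c
  | 8 => z-1+(1-z)*c - O z d c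
  | 9 => z+2+z*d - O z d c
  | 10 => z+2+d - O z d c
  | 11 => u+v - O z d c
  | 12 => 0 - O z d c
  | 13 => z-1 - O z d c
  | 14 => z - O z d c
  | 15 => z+1 - O z d c
  | 16 => z+2 - O z d c
  | 17 => 2 - O z d c
  | 18 => 1 - O z d c
  | _ => 0

lemma E1 {A k X : ℂ} (hk : ‖k‖ = 1) (hX : ‖X‖ = 1) (h : A = k * X) : ‖A‖ = 1 := by
  rw [h, norm_mul, hk, hX, one_mul]

lemma base_edges {z u v d c : ℂ} (hz : z^2 = z-1) (hd : 2*d = u+(1-z)*v+v-(z+2))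
    (k1 : ‖(1:ℂ)‖ = 1) (k2 : ‖(-1:ℂ)‖ = 1) (k3 : ‖z‖ = 1) (k4 : ‖-z‖ = 1) (k5 : ‖z-1‖ = 1) (k6 : ‖1-z‖ = 1)
    (x1 : ‖u‖ = 1) (x2 : ‖v‖ = 1) (x3 : ‖2-u-v‖ = 1) (x4 : ‖d‖ = 1) (x5 : ‖c‖ = 1) (x6 : ‖z-1+2*c-u‖ = 1) :
    ∀ t ∈ base, ‖Q z u v d c t.1 - (z-1)^t.2.2 * Q z u v d c t.2.1‖ = 1 := by
  simp only [base, List.forall_mem_cons]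
  refine ⟨?_, ?_, ?_, ?_, ?_, ?_, ?_, ?_, ?_, ?_, ?_, ?_, ?_, ?_, ?_, ?_, ?_, ?_, ?_, ?_, ?_, ?_, ?_, ?_, ?_, ?_, ?_, ?_, ?_, ?_, ?_, ?_, ?_, ?_, ?_, ?_, ?_, by simp⟩
  · exact E1 (k := z) (X := c) (by assumption) (by assumption) (by simp only [Q, O]; ring)
  · exact E1 (k := z) (X := c) (by assumption) (by assumption) (by simp only [Q, O]; linear_combination -(1+2/3*c+4/3*d)*hz)
  · exact E1 (k := (z-1)) (X := d) (by assumption) (by assumption) (by simp only [Q, O]; ring)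
  · exact E1 (k := (z-1)) (X := d) (by assumption) (by assumption) (by simp only [Q, O]; ring)
  · exact E1 (k := 1) (X := v) (by assumption) (by assumption) (by simp only [Q, O]; linear_combination hd)
  · exact E1 (k := (1-z)) (X := v) (by assumption) (by assumption) (by simp only [Q, O]; ring)
  · exact E1 (k := (-1)) (X := (z-1+2*c-u)) (by assumption) (by assumption) (by simp only [Q, O]; ring)
  · exact E1 (k := 1) (X := c) (by assumption) (by assumption) (by simp only [Q, O]; ring)
  · exact E1 (k := (z-1)) (X := c) (by assumption) (by assumption) (by simp only [Q, O]; ring)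
  · exact E1 (k := 1) (X := c) (by assumption) (by assumption) (by simp only [Q, O]; ring)
  · exact E1 (k := (z-1)) (X := c) (by assumption) (by assumption) (by simp only [Q, O]; linear_combination -(1+2/3*c+4/3*d)*hz)
  · exact E1 (k := z) (X := d) (by assumption) (by assumption) (by simp only [Q, O]; ring)
  · exact E1 (k := (-1)) (X := d) (by assumption) (by assumption) (by simp only [Q, O]; ring)
  · exact E1 (k := z) (X := d) (by assumption) (by assumption) (by simp only [Q, O]; ring)
  · exact E1 (k := (-1)) (X := d) (by assumption) (by assumption) (by simp only [Q, O]; ring)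
  · exact E1 (k := (1-z)) (X := v) (by assumption) (by assumption) (by simp only [Q, O]; linear_combination hd)
  · exact E1 (k := z) (X := v) (by assumption) (by assumption) (by simp only [Q, O]; ring)
  · exact E1 (k := 1) (X := v) (by assumption) (by assumption) (by simp only [Q, O]; ring)
  · exact E1 (k := 1) (X := u) (by assumption) (by assumption) (by simp only [Q, O]; ring)
  · exact E1 (k := (1-z)) (X := (1:ℂ)) (by assumption) (by assumption) (by simp only [Q, O]; ring)
  · exact E1 (k := (-1)) (X := c) (by assumption) (by assumption) (by simp only [Q, O]; ring)
  · exact E1 (k := z) (X := c) (by assumption) (by assumption) (by simp only [Q, O]; ring)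
  · exact E1 (k := (1-z)) (X := c) (by assumption) (by assumption) (by simp only [Q, O]; ring)
  · exact E1 (k := (-1)) (X := (1:ℂ)) (by assumption) (by assumption) (by simp only [Q, O]; ring)
  · exact E1 (k := (-1)) (X := (1:ℂ)) (by assumption) (by assumption) (by simp only [Q, O]; ring)
  · exact E1 (k := (-1)) (X := (1:ℂ)) (by assumption) (by assumption) (by simp only [Q, O]; ring)
  · exact E1 (k := (-z)) (X := d) (by assumption) (by assumption) (by simp only [Q, O]; ring)
  · exact E1 (k := (z-1)) (X := d) (by assumption) (by assumption) (by simp only [Q, O]; ring)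
  · exact E1 (k := 1) (X := d) (by assumption) (by assumption) (by simp only [Q, O]; ring)
  · exact E1 (k := z) (X := (1:ℂ)) (by assumption) (by assumption) (by simp only [Q, O]; ring)
  · exact E1 (k := 1) (X := (2-u-v)) (by assumption) (by assumption) (by simp only [Q, O]; ring)
  · exact E1 (k := 1) (X := (1:ℂ)) (by assumption) (by assumption) (by simp only [Q, O]; ring)
  · exact E1 (k := 1) (X := (1:ℂ)) (by assumption) (by assumption) (by simp only [Q, O]; ring)
  · exact E1 (k := (-z)) (X := (1:ℂ)) (by assumption) (by assumption) (by simp only [Q, O]; ring)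
  · exact E1 (k := (z-1)) (X := (1:ℂ)) (by assumption) (by assumption) (by simp only [Q, O]; ring)
  · exact E1 (k := (-z)) (X := (1:ℂ)) (by assumption) (by assumption) (by simp only [Q, O]; ring)
  · exact E1 (k := (z-1)) (X := (1:ℂ)) (by assumption) (by assumption) (by simp only [Q, O]; ring)
lemma O_mk (r d1 d2 c1 c2 : ℝ) : O ⟨1/2, r/2⟩ ⟨d1, d2⟩ ⟨c1, c2⟩ =
    ⟨1 + c1 + r*c2/3 + d1 - r*d2/3, c2 - r*c1/3 + d2 + r*d1/3⟩ := by
  apply Complex.ext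
  · simp [O]; ring
  · simp [O]; ring

lemma rb {r x m e : ℝ} (hr : (1.7320508:ℝ) ≤ r ∧ r ≤ 1.7320509) (hx : |x - m| ≤ e) (hm : |m| ≤ 1) :
    |r*x - 1.7320508*m| ≤ 1.7321*e+0.0000002 := by
  rw [abs_le] at *
  obtain ⟨h1, h2⟩ := hr
  have a : 0 ≤ r := by norm_num at *; linarith
  have b1 := mul_nonneg a (sub_nonneg.2 hx.1)
  have b2 := mul_nonneg a (sub_nonneg.2 hx.2)
  have he0 : 0 ≤ e := by linarith
  have b3 : r * e ≤ 1.7321 * e := mul_le_mul_of_nonneg_right (by norm_num at *; linarith) he0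
  have b4 := mul_nonneg (sub_nonneg.2 h1) (by linarith : 0 ≤ 1 - m)
  have b5 := mul_nonneg (sub_nonneg.2 h1) (by linarith : 0 ≤ 1 + m)
  norm_num at *
  constructor <;> nlinarith

set_option maxHeartbeats 4000000 in
lemma approx0 {r u1 u2 v1 v2 d1 d2 c1 c2 : ℝ} (hr : (1.7320508:ℝ) ≤ r ∧ r ≤ 1.7320509)
    (h1 : |u1-0.251465|≤0.000005) (h2 : |u2+0.967866|≤0.00001) (h3 : |v1-0.892806|≤0.000005)
    (h4 : |v2-0.450440|≤0.000005) (h5 : |d1+0.259616|≤0.000005) (h6 : |d2+0.965712|≤0.000005)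
    (h7 : |c1+0.118456|≤0.00005) (h8 : |c2+0.992959|≤0.00005) (j : ℕ) (hj : j < 19) :
    |sc (Q ⟨1/2, r/2⟩ ⟨u1,u2⟩ ⟨v1,v2⟩ ⟨d1,d2⟩ ⟨c1,c2⟩ j).re - bx j| ≤ 2 ∧
    |sc (Q ⟨1/2, r/2⟩ ⟨u1,u2⟩ ⟨v1,v2⟩ ⟨d1,d2⟩ ⟨c1,c2⟩ j).im - byy j| ≤ 2 := by
  have k3 := rb hr h3 (by norm_num [abs_le])
  have k4 := rb hr h4 (by norm_num [abs_le])
  have k5 := rb (m := -0.259616) hr (by simpa using h5) (by norm_num [abs_le])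
  have k6 := rb (m := -0.965712) hr (by simpa using h6) (by norm_num [abs_le])
  have k7 := rb (m := -0.118456) hr (by simpa using h7) (by norm_num [abs_le])
  have k8 := rb (m := -0.992959) hr (by simpa using h8) (by norm_num [abs_le])
  rw [abs_le] at h1 h2 h3 h4 h5 h6 h7 h8 k3 k4 k5 k6 k7 k8
  obtain ⟨r1, r2⟩ := hr
  norm_num at h1 h2 h3 h4 h5 h6 h7 h8 k3 k4 k5 k6 k7 k8 r1 r2
  rw [abs_le, abs_le]
  interval_cases j <;> simp only [Q, O_mk] <;> simp [sc, bx, byy, CX, CY] <;> refine ⟨⟨?_, ?_⟩, ⟨?_, ?_⟩⟩ <;> linarith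

lemma w_re1 (r : ℝ) (X : ℂ) : (((⟨1/2, r/2⟩:ℂ)-1)*X).re = -X.re/2 - r*X.im/2 := by
  simp; ring
lemma w_im1 (r : ℝ) (X : ℂ) : (((⟨1/2, r/2⟩:ℂ)-1)*X).im = r*X.re/2 - X.im/2 := by
  simp; ring
lemma hz_mk {r : ℝ} (h : r^2 = 3) : (⟨1/2, r/2⟩:ℂ)^2 = ⟨1/2, r/2⟩ - 1 := by
  apply Complex.ext
  · simp [pow_two]; linarith
  · simp [pow_two]; ring
lemma w_re2 {r : ℝ} (h : r^2 = 3) (X : ℂ) : (((⟨1/2, r/2⟩:ℂ)-1)^2*X).re = -X.re/2 + r*X.im/2 := by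
  have : ((⟨1/2, r/2⟩:ℂ)-1)^2 = -⟨1/2, r/2⟩ := by linear_combination hz_mk h
  rw [this]; simp; ring
lemma w_im2 {r : ℝ} (h : r^2 = 3) (X : ℂ) : (((⟨1/2, r/2⟩:ℂ)-1)^2*X).im = -r*X.re/2 - X.im/2 := by
  have : ((⟨1/2, r/2⟩:ℂ)-1)^2 = -⟨1/2, r/2⟩ := by linear_combination hz_mk h
  rw [this]; simp; ring

def leA (a b c : ℤ) : Bool := decide (-24000000 ≤ 20000000*a+10000000*b+17320508*c) &&
  decide (20000000*a+10000000*b+17320508*c ≤ 24000000)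
def rotOK (j : ℕ) : Bool :=
  leA (bx (j+19) - 40000) (bx j - 40000) (byy j - 40000) &&
  (leA (byy (j+19) - 40000) (byy j - 40000) (-(bx j - 40000)) &&
  (leA (bx (j+38) - 40000) (bx j - 40000) (-(byy j - 40000)) &&
  (leA (byy (j+38) - 40000) (byy j - 40000) (bx j - 40000) &&
  (decide (bx j ≤ 80000) && decide (byy j ≤ 80000)))))
lemma rot_all : ∀ j < 19, rotOK j = true := by decide +kernel

lemma rot_err {r X Y X' : ℝ} {b c a : ℤ} (hr : (1.7320508:ℝ) ≤ r ∧ r ≤ 1.7320509)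
    (hX : |10000*X - b| ≤ 2) (hY : |10000*Y - c| ≤ 2) (hc : |(c:ℝ)| ≤ 40000) (h : leA a b c = true)
    (e : X' = -X/2 - r*Y/2) : |10000*X' - a| ≤ 4 := by
  simp only [leA, Bool.and_eq_true, decide_eq_true_eq] at h
  obtain ⟨h1, h2⟩ := h
  have h1' : (-24000000:ℝ) ≤ 20000000*a+10000000*b+17320508*c := by exact_mod_cast h1
  have h2' : (20000000:ℝ)*a+10000000*b+17320508*c ≤ 24000000 := by exact_mod_cast h2
  rw [e]
  rw [abs_le] at *
  obtain ⟨r1, r2⟩ := hr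
  norm_num at r1 r2
  have hr0 : 0 ≤ r := by linarith
  have b1 := mul_nonneg hr0 (sub_nonneg.2 hY.1)
  have b2 := mul_nonneg hr0 (sub_nonneg.2 hY.2)
  have b4 := mul_nonneg (sub_nonneg.2 r1) (by linarith : (0:ℝ) ≤ 40000 - c)
  have b5 := mul_nonneg (sub_nonneg.2 r1) (by linarith : (0:ℝ) ≤ 40000 + c)
  constructor <;> nlinarith

lemma Ap_iff (X : ℝ) (n : ℕ) : Ap (sc X) n ↔ |10000*X - ((n - 40000 : ℤ):ℝ)| ≤ 4 := by
  unfold Ap sc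
  push_cast
  rw [show 10000*X+40000 - (n:ℝ) = 10000*X - (n-40000) by ring]

lemma rot_approx {r : ℝ} {q : ℕ → ℂ} (hr : (1.7320508:ℝ) ≤ r ∧ r ≤ 1.7320509) (h3 : r^2 = 3)
    (hx : ∀ j < 19, |sc (q j).re - bx j| ≤ 2 ∧ |sc (q j).im - byy j| ≤ 2) (n : ℕ) (hn : n < 57) :
    Ap (sc ((((⟨1/2, r/2⟩:ℂ)-1)^(n/19) * q (n%19))).re) (bx n) ∧
    Ap (sc ((((⟨1/2, r/2⟩:ℂ)-1)^(n/19) * q (n%19))).im) (byy n) := by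
  have hj : n%19 < 19 := Nat.mod_lt _ (by norm_num)
  have hk : n/19 < 3 := by omega
  have hnn : n = 19*(n/19) + n%19 := by omega
  generalize n%19 = j at *
  generalize n/19 = k at *
  obtain ⟨a1, a2⟩ := hx j hj
  have ro := rot_all j hj
  simp only [rotOK, Bool.and_eq_true, decide_eq_true_eq] at ro
  obtain ⟨o1, o2, o3, o4, o5, o6⟩ := ro
  have a1' : |10000*(q j).re - ((bx j - 40000 : ℤ):ℝ)| ≤ 2 := by
    have : 10000*(q j).re - ((bx j - 40000 : ℤ):ℝ) = sc (q j).re - bx j := by unfold sc; push_cast; ring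
    rw [this]; exact a1
  have a2' : |10000*(q j).im - ((byy j - 40000 : ℤ):ℝ)| ≤ 2 := by
    have : 10000*(q j).im - ((byy j - 40000 : ℤ):ℝ) = sc (q j).im - byy j := by unfold sc; push_cast; ring
    rw [this]; exact a2
  have a3' : |10000*(-(q j).re) - ((-(bx j - 40000) : ℤ):ℝ)| ≤ 2 := by
    rw [← abs_neg]; push_cast at *; convert a1' using 2; ring
  have a4' : |10000*(-(q j).im) - ((-(byy j - 40000) : ℤ):ℝ)| ≤ 2 := by
    rw [← abs_neg]; push_cast at *; convert a2' using 2; ring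
  have c1 : |((bx j - 40000 : ℤ):ℝ)| ≤ 40000 := by
    have : (bx j:ℝ) ≤ 80000 := by exact_mod_cast o5
    have : (0:ℝ) ≤ bx j := by positivity
    push_cast; rw [abs_le]; constructor <;> linarith
  have c2 : |((byy j - 40000 : ℤ):ℝ)| ≤ 40000 := by
    have : (byy j:ℝ) ≤ 80000 := by exact_mod_cast o6
    have : (0:ℝ) ≤ byy j := by positivity
    push_cast; rw [abs_le]; constructor <;> linarith
  have c3 : |((-(bx j - 40000) : ℤ):ℝ)| ≤ 40000 := by rw [Int.cast_neg, abs_neg]; exact c1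
  have c4 : |((-(byy j - 40000) : ℤ):ℝ)| ≤ 40000 := by rw [Int.cast_neg, abs_neg]; exact c2
  rw [Ap_iff, Ap_iff]
  interval_cases k
  · have : n = j := by omega
    subst this
    simp only [pow_zero, one_mul]
    exact ⟨a1'.trans (by norm_num), a2'.trans (by norm_num)⟩
  · have : n = j+19 := by omega
    subst this
    simp only [pow_one]
    exact ⟨rot_err hr a1' a2' c2 o1 (w_re1 _ _), rot_err hr a2' a3' c3 o2 (by rw [w_im1]; ring)⟩
  · have : n = j+38 := by omega
    subst this
    exact ⟨rot_err hr a1' a4' c4 o3 (by rw [w_re2 h3]; ring), rot_err hr a2' a1' c1 o4 (by rw [w_im2 h3]; ring)⟩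
lemma mk_edge {om : ℂ} {q : ℕ → ℂ} {l : ℝ} (h3 : om^3 = 1) (h1 : ‖om‖ = 1) (k : ℕ) (hk : k < 3) (e : ℕ × ℕ × ℕ)
    (ha : e.1 < 19) (hb : e.2.1 < 19) (h : ‖q e.1 - om^e.2.2 * q e.2.1‖ = l) :
    ‖om^((mk k e).1/19) * q ((mk k e).1%19) - om^((mk k e).2/19) * q ((mk k e).2%19)‖ = l := by
  obtain ⟨a, b, s⟩ := e
  simp only [] at *
  have d1 : (19*k+a)/19 = k := by omega
  have d2 : (19*k+a)%19 = a := by omega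
  have d3 : (19*((k+s)%3)+b)/19 = (k+s)%3 := by omega
  have d4 : (19*((k+s)%3)+b)%19 = b := by omega
  have hp : om^((k+s)%3) = om^k * om^s := by
    rw [← pow_add, ← Nat.mod_add_div (k+s) 3, pow_add, pow_mul, h3]
    simp
  have key : ‖om^k * q a - om^((k+s)%3) * q b‖ = l := by
    rw [hp, mul_assoc, ← mul_sub, norm_mul, norm_pow, h1, one_pow, one_mul, h]
  unfold mk
  simp only []
  split_ifs
  · simp only [d1, d2, d3, d4]; exact key
  · simp only [d1, d2, d3, d4]; rw [norm_sub_rev]; exact key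

lemma base_lt : ∀ e ∈ base, e.1 < 19 ∧ e.2.1 < 19 := by decide +kernel

lemma t_bound {A B : ℂ} (h1 : Ap (sc A.re) 44818) (h2 : Ap (sc A.im) 45243) (h3 : Ap (sc B.re) 54685)
    (h4 : Ap (sc B.im) 47030) : ‖A - B‖ ≠ 1 ∧ |‖A - B‖ - 1| < 0.013 := by
  have hn : ‖A - B‖^2 = (A.re-B.re)^2+(A.im-B.im)^2 := by
    rw [Complex.sq_norm, Complex.normSq_apply]; simp; ring
  have h0 := norm_nonneg (A - B)
  unfold Ap sc at *
  rw [abs_le] at *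
  push_cast at *
  have e1 : 0.9859 ≤ B.re - A.re ∧ B.re - A.re ≤ 0.9875 := by norm_num at *; constructor <;> linarith
  have e2 : 0.1779 ≤ B.im - A.im ∧ B.im - A.im ≤ 0.1795 := by norm_num at *; constructor <;> linarith
  have p1 := mul_self_le_mul_self (by norm_num) e1.1
  have p2 := mul_self_le_mul_self (by norm_num at *; linarith) e1.2
  have p3 := mul_self_le_mul_self (by norm_num) e2.1
  have p4 := mul_self_le_mul_self (by norm_num at *; linarith) e2.2
  generalize ‖A - B‖ = t at *
  have q1 : 1.0036 ≤ t^2 := by norm_num at *; linarith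
  have q2 : t^2 ≤ 1.0075 := by norm_num at *; linarith
  have r1 : 1 < t := by norm_num at *; nlinarith
  refine ⟨r1.ne', ?_⟩
  rw [abs_lt]
  norm_num at *
  constructor
  · linarith
  · nlinarith

lemma nrm {a b : ℝ} (h : a^2+b^2 = 1) : ‖(⟨a, b⟩:ℂ)‖ = 1 := by
  rw [Complex.norm_eq_sqrt_sq_add_sq]; simp [h]
lemma nrm' {A : ℂ} {a b : ℝ} (h : a^2+b^2 = 1) (h1 : A.re = a) (h2 : A.im = b) : ‖A‖ = 1 := by
  rw [Complex.norm_eq_sqrt_sq_add_sq, h1, h2]; simp [h]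
end
end NM

theorem near_matchstick_57 :
    ∃ (P : Fin 57 → EuclideanSpace ℝ (Fin 2)) (E : Finset (Fin 57 × Fin 57)),
      Function.Injective P ∧
      (∀ e ∈ E, e.1 < e.2) ∧
      E.card = 114 ∧
      (∀ v : Fin 57, (E.filter (fun e => e.1 = v ∨ e.2 = v)).card = 4) ∧
      (∀ e ∈ E, ∀ f ∈ E, e ≠ f →
        ∀ x ∈ segment ℝ (P e.1) (P e.2) ∩ segment ℝ (P f.1) (P f.2),
          (x = P e.1 ∨ x = P e.2) ∧ (x = P f.1 ∨ x = P f.2)) ∧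
      (E.filter (fun e => dist (P e.1) (P e.2) = 1)).card = 111 ∧
      (∃ t : ℝ, |t - 1| < 0.013 ∧
        ∀ e ∈ E, dist (P e.1) (P e.2) = 1 ∨ dist (P e.1) (P e.2) = t) := by
  obtain ⟨u1, u2, v1, v2, d1, d2, hu, hv, hd, huv, hd1, hd2, b1, b2, b3, b4, b5, b6⟩ := NM.exist_uvd
  obtain ⟨c1, c2, hc, hcu, b7, b8⟩ := NM.exist_c b1 b2
  have hr := NM.sqrt3_bd
  have hr3 : (√3:ℝ)^2 = 3 := Real.sq_sqrt (by norm_num)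
  generalize (√3:ℝ) = r at *
  have ap := NM.approx0 hr b1 b2 b3 b4 b5 b6 b7 b8
  have ra := NM.rot_approx hr hr3 ap
  have hz := NM.hz_mk hr3
  have k3 : ‖(⟨1/2, r/2⟩:ℂ)‖ = 1 := NM.nrm (by linarith)
  have k5 : ‖(⟨1/2, r/2⟩:ℂ) - 1‖ = 1 := NM.nrm' (a := -1/2) (b := r/2) (by linarith) (by simp; norm_num) (by simp)
  have h3 : ((⟨1/2, r/2⟩:ℂ) - 1)^3 = 1 := by
    linear_combination ((⟨1/2, r/2⟩:ℂ) - 2) * hz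
  have be := NM.base_edges (u := ⟨u1, u2⟩) (v := ⟨v1, v2⟩) (d := ⟨d1, d2⟩) (c := ⟨c1, c2⟩) hz
    (by
      apply Complex.ext
      · simp; linarith
      · simp; linarith)
    (by simp) (by simp) k3 (by rw [norm_neg]; exact k3) k5 (by rw [norm_sub_rev]; exact k5)
    (NM.nrm hu) (NM.nrm hv) (NM.nrm' (a := 2-u1-v1) (b := -(u2+v2)) (by rw [neg_sq]; exact huv) (by simp) (by simp; ring))
    (NM.nrm hd) (NM.nrm hc) (NM.nrm' hcu (by simp; norm_num) (by simp))
  generalize NM.Q ⟨1/2, r/2⟩ ⟨u1,u2⟩ ⟨v1,v2⟩ ⟨d1,d2⟩ ⟨c1,c2⟩ = q at *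
  generalize (⟨1/2, r/2⟩:ℂ) - 1 = om at *
  have tb := NM.t_bound (ra 0 (by norm_num)).1 (ra 0 (by norm_num)).2 (ra 39 (by norm_num)).1 (ra 39 (by norm_num)).2
  have hbad : ‖q 0 - om^2 * q 1‖ = ‖om ^ (0 / 19) * q (0 % 19) - om ^ (39 / 19) * q (39 % 19)‖ := by norm_num
  rw [← hbad] at tb
  refine NM.assemble (fun n => om^(n/19) * q (n%19)) _ (fun n hn => (ra n hn).1) (fun n hn => (ra n hn).2) ?_ ?_ tb.1 tb.2
  · intro e he
    simp only [NM.goodN, List.mem_append, List.mem_map] at he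
    rcases he with (⟨f, hf, rfl⟩ | ⟨f, hf, rfl⟩) | ⟨f, hf, rfl⟩
    · exact NM.mk_edge h3 k5 0 (by norm_num) f (NM.base_lt f hf).1 (NM.base_lt f hf).2 (be f hf)
    · exact NM.mk_edge h3 k5 1 (by norm_num) f (NM.base_lt f hf).1 (NM.base_lt f hf).2 (be f hf)
    · exact NM.mk_edge h3 k5 2 (by norm_num) f (NM.base_lt f hf).1 (NM.base_lt f hf).2 (be f hf)
  · intro e he
    simp only [NM.badN, List.mem_cons, List.not_mem_nil, or_false] at he
    rcases he with rfl | rfl | rfl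
    · exact NM.mk_edge h3 k5 0 (by norm_num) (0,1,2) (by norm_num) (by norm_num) rfl
    · exact NM.mk_edge h3 k5 1 (by norm_num) (0,1,2) (by norm_num) (by norm_num) rfl
    · exact NM.mk_edge h3 k5 2 (by norm_num) (0,1,2) (by norm_num) (by norm_num) rfl
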